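/- arXiv:2207.14771 — 2 statements merged into one kernel-verified Lean document; each statement's English description precedes it below -/
import Mathlib

section
/- Let α, γ, θ, t ∈ ℝ and k ∈ ℤ with |k| ≥ 2, and define P_k(x,t) = cos²θ · J_{x+k}(2t)² + sin²θ · J_{x-k}(2t)² + 2(−1)^k cos(2αk + γ) · cos θ sin θ · J_{x+k}(2t) J_{x-k}(2t). Then the function x ↦ x²·P_k(x,t) is summable over ℤ and ∑_{x ∈ ℤ} x²·P_k(x,t) = 2t² + k². In particular, the second moment of the walker's position does not depend on the direction phase α or on the relative phase γ. -/
open scoped Real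

/-- Bessel function of the first kind of integer order `n`:
`J_n(x) = (1/π) ∫₀^π cos (n τ - x sin τ) dτ`. -/
noncomputable def besselJ (n : ℤ) (x : ℝ) : ℝ :=
  (1 / Real.pi) * ∫ τ in (0 : ℝ)..Real.pi, Real.cos (n * τ - x * Real.sin τ)

/-- The probability distribution of the directed quantum walk started from
`cos θ |-k⟩ + e^{iγ} sin θ |k⟩` (equation (19) of the paper). -/
noncomputable def P (α γ θ : ℝ) (k x : ℤ) (t : ℝ) : ℝ :=
  Real.cos θ ^ 2 * besselJ (x + k) (2 * t) ^ 2
    + Real.sin θ ^ 2 * besselJ (x - k) (2 * t) ^ 2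
    + 2 * (-1 : ℝ) ^ k * Real.cos (2 * α * k + γ) * Real.cos θ * Real.sin θ
        * besselJ (x + k) (2 * t) * besselJ (x - k) (2 * t)

instance factTwoPi : Fact (0 < 2 * π) := ⟨Real.two_pi_pos⟩

noncomputable def genF (z : ℝ) : C(AddCircle (2 * π), ℂ) where
  toFun θ := Complex.exp (Complex.I * ((z * Real.Angle.sin θ : ℝ) : ℂ))
  continuous_toFun := by
    have h : Continuous (fun θ : AddCircle (2 * π) => Real.Angle.sin θ) := Real.Angle.continuous_sin
    fun_prop

theorem genF_coe (z τ : ℝ) :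
    genF z (τ : AddCircle (2 * π)) = Complex.exp (Complex.I * ((z * Real.sin τ : ℝ) : ℂ)) := by
  show Complex.exp (Complex.I * ((z * Real.Angle.sin (τ : Real.Angle) : ℝ) : ℂ)) = _
  rw [Real.Angle.sin_coe]

theorem coeff_genF (z : ℝ) (n : ℤ) : fourierCoeff (genF z) n = (besselJ n z : ℂ) := by
  rw [fourierCoeff_eq_intervalIntegral _ _ (-π)]
  have e : -π + 2 * π = π := by ring
  rw [e]
  set g : ℝ → ℂ := fun τ => Complex.exp (-Complex.I * ((n * τ - z * Real.sin τ : ℝ) : ℂ)) with hg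
  have hgc : Continuous g := by fun_prop
  have h1 : (∫ x in (-π)..π, fourier (-n) (x : AddCircle (2 * π)) • genF z (x : AddCircle (2 * π)))
      = ∫ x in (-π)..π, g x := by
    congr 1
    ext x
    rw [genF_coe, fourier_coe_apply, smul_eq_mul, ← Complex.exp_add, hg]
    congr 1
    have : (π : ℂ) ≠ 0 := by exact_mod_cast Real.pi_ne_zero
    push_cast
    field_simp
    ring
  have h2 : (∫ x in (-π)..π, g x) = ∫ x in (0:ℝ)..π, (g (-x) + g x) := by
    have hgn : Continuous (fun x => g (-x)) := hgc.comp continuous_neg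
    rw [intervalIntegral.integral_add
      (hgn.intervalIntegrable _ _) (hgc.intervalIntegrable _ _),
      intervalIntegral.integral_comp_neg, neg_zero]
    exact (intervalIntegral.integral_add_adjacent_intervals
      (hgc.intervalIntegrable _ _) (hgc.intervalIntegrable _ _)).symm
  have h3 : ∀ x : ℝ, g (-x) + g x = ((2 * Real.cos (n * x - z * Real.sin x) : ℝ) : ℂ) := by
    intro x
    simp only [hg]
    rw [Real.sin_neg]
    push_cast
    rw [Complex.two_cos]
    congr 2 <;> ring
  rw [h1, h2]
  simp_rw [h3]
  rw [intervalIntegral.integral_ofReal, intervalIntegral.integral_const_mul, besselJ,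
    Complex.real_smul, ← Complex.ofReal_mul]
  congr 1
  field_simp

theorem coeff_shift (z : ℝ) (m n : ℤ) :
    fourierCoeff (fourier m * genF z : C(AddCircle (2 * π), ℂ)) n = (besselJ (n - m) z : ℂ) := by
  rw [← coeff_genF]
  unfold fourierCoeff
  congr 1
  ext x
  simp only [ContinuousMap.coe_mul, Pi.mul_apply, smul_eq_mul]
  rw [← mul_assoc, ← fourier_add]
  congr 3
  ring

theorem genF_conj (z : ℝ) (x : AddCircle (2 * π)) :
    (starRingEnd ℂ) (genF z x) * genF z x = 1 := by
  simp only [genF, ContinuousMap.coe_mk]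
  rw [← Complex.exp_conj, ← Complex.exp_add]
  simp

theorem hasSum_aux (z : ℝ) (m : ℤ) :
    HasSum (fun n : ℤ => besselJ n z * besselJ (n - m) z) (if m = 0 then 1 else 0) := by
  let F := ContinuousMap.toLp (E := ℂ) 2 (AddCircle.haarAddCircle (T := 2 * π)) ℂ (genF z)
  let G := ContinuousMap.toLp (E := ℂ) 2 (AddCircle.haarAddCircle (T := 2 * π)) ℂ (fourier m * genF z)
  have H := (fourierBasis (T := 2 * π)).hasSum_inner_mul_inner F G
  have hG : ∀ n, inner ℂ (fourierBasis (T := 2 * π) n) G = (besselJ (n - m) z : ℂ) := by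
    intro n
    rw [← HilbertBasis.repr_apply_apply, fourierBasis_repr, fourierCoeff_toLp, coeff_shift]
  have hF : ∀ n, inner ℂ F (fourierBasis (T := 2 * π) n) = (besselJ n z : ℂ) := by
    intro n
    rw [← inner_conj_symm, ← HilbertBasis.repr_apply_apply, fourierBasis_repr, fourierCoeff_toLp,
      coeff_genF, Complex.conj_ofReal]
  have hI : inner ℂ F G = (((if m = 0 then 1 else 0 : ℝ)) : ℂ) := by
    rw [MeasureTheory.ContinuousMap.inner_toLp]
    have := fourierCoeff_fourier (T := 2 * π) m
    have h0 := congrFun this 0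
    unfold fourierCoeff at h0
    simp only [neg_zero, fourier_zero, one_smul] at h0
    have : ∀ x : AddCircle (2 * π), (fourier m * genF z : C(AddCircle (2 * π), ℂ)) x * (starRingEnd ℂ) (genF z x) = fourier m x := by
      intro x
      rw [ContinuousMap.mul_apply, mul_assoc, mul_comm (genF z x), genF_conj, mul_one]
    simp_rw [this]
    rw [h0]
    by_cases hm : m = 0
    · simp [hm]
    · simp [hm, Pi.single_apply, Ne.symm hm]
  rw [hI] at H
  simp_rw [hF, hG] at H
  exact_mod_cast H

theorem hasSum_JJ (z : ℝ) (p q : ℤ) :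
    HasSum (fun x : ℤ => besselJ (x + p) z * besselJ (x + q) z) (if p = q then 1 else 0) := by
  have h := (Equiv.addRight p).hasSum_iff.mpr (hasSum_aux z (p - q))
  simp only [sub_eq_zero] at h
  convert h using 2 with x
  simp only [Function.comp, Equiv.coe_addRight]
  congr 2
  ring

theorem bessel_rec (n : ℤ) (t : ℝ) :
    (n : ℝ) * besselJ n (2 * t) = t * (besselJ (n - 1) (2 * t) + besselJ (n + 1) (2 * t)) := by
  have hc : ∀ m : ℤ, IntervalIntegrable (fun τ => Real.cos (m * τ - 2 * t * Real.sin τ))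
      MeasureTheory.volume 0 π := fun m => by
    apply Continuous.intervalIntegrable; fun_prop
  have hd : ∀ τ ∈ Set.uIcc 0 π, HasDerivAt (fun τ => Real.sin (n * τ - 2 * t * Real.sin τ))
      (Real.cos (n * τ - 2 * t * Real.sin τ) * (n * 1 - 2 * t * Real.cos τ)) τ := by
    intro τ _
    exact (((hasDerivAt_id τ).const_mul (n : ℝ)).sub ((Real.hasDerivAt_sin τ).const_mul (2 * t))).sin
  have hI := intervalIntegral.integral_eq_sub_of_hasDerivAt hd (by
    apply Continuous.intervalIntegrable; fun_prop)
  simp only [Real.sin_pi, Real.sin_zero, mul_zero, sub_zero, Real.sin_int_mul_pi] at hI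
  have h2 : (∫ τ in (0:ℝ)..π, Real.cos (n * τ - 2 * t * Real.sin τ) * (n * 1 - 2 * t * Real.cos τ))
      = ∫ τ in (0:ℝ)..π, (n * Real.cos (n * τ - 2 * t * Real.sin τ)
        - t * (Real.cos ((n - 1 : ℤ) * τ - 2 * t * Real.sin τ)
          + Real.cos ((n + 1 : ℤ) * τ - 2 * t * Real.sin τ))) := by
    congr 1
    ext τ
    have e1 : ((n - 1 : ℤ) : ℝ) * τ - 2 * t * Real.sin τ = (n * τ - 2 * t * Real.sin τ) - τ := by
      push_cast; ring
    have e2 : ((n + 1 : ℤ) : ℝ) * τ - 2 * t * Real.sin τ = (n * τ - 2 * t * Real.sin τ) + τ := by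
      push_cast; ring
    rw [e1, e2]
    generalize (n : ℝ) * τ - 2 * t * Real.sin τ = u
    rw [Real.cos_sub, Real.cos_add]
    ring
  rw [h2, intervalIntegral.integral_sub ((hc n).const_mul _) (((hc _).add (hc _)).const_mul _),
    intervalIntegral.integral_const_mul, intervalIntegral.integral_const_mul,
    intervalIntegral.integral_add (hc _) (hc _)] at hI
  unfold besselJ
  linear_combination (1 / π) * hI

/-- Sum of a product of two "three-term" sequences. -/
theorem hasSum_three (z t c d : ℝ) (p q : ℤ) :
    HasSum (fun x : ℤ =>
      (t * (besselJ (x + (p - 1)) z + besselJ (x + (p + 1)) z) + c * besselJ (x + p) z) *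
      (t * (besselJ (x + (q - 1)) z + besselJ (x + (q + 1)) z) + d * besselJ (x + q) z))
      (t * t * ((if p - 1 = q - 1 then 1 else 0) + (if p - 1 = q + 1 then 1 else 0)
        + (if p + 1 = q - 1 then 1 else 0) + (if p + 1 = q + 1 then 1 else 0))
       + t * d * ((if p - 1 = q then 1 else 0) + (if p + 1 = q then 1 else 0))
       + c * t * ((if p = q - 1 then 1 else 0) + (if p = q + 1 then 1 else 0))
       + c * d * (if p = q then 1 else 0)) := by
  have H := ((((((hasSum_JJ z (p - 1) (q - 1)).add (hasSum_JJ z (p - 1) (q + 1))).add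
    (hasSum_JJ z (p + 1) (q - 1))).add (hasSum_JJ z (p + 1) (q + 1))).mul_left (t * t)).add
    (((hasSum_JJ z (p - 1) q).add (hasSum_JJ z (p + 1) q)).mul_left (t * d))).add
    (((hasSum_JJ z p (q - 1)).add (hasSum_JJ z p (q + 1))).mul_left (c * t)) |>.add
    ((hasSum_JJ z p q).mul_left (c * d))
  refine H.congr_fun (fun x => ?_)
  ring

/-- For `|k| ≥ 2`, the second moment of the walker's position is `2t² + k²`: it does not
depend on the direction phase `α` or on the relative phase `γ`. -/
theorem second_moment (α γ θ t : ℝ) (k : ℤ) (hk : 2 ≤ |k|) :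
    Summable (fun x : ℤ => (x : ℝ) ^ 2 * P α γ θ k x t) ∧
    ∑' x : ℤ, (x : ℝ) ^ 2 * P α γ θ k x t = 2 * t ^ 2 + (k : ℝ) ^ 2 := by
  suffices h : HasSum (fun x : ℤ => (x : ℝ) ^ 2 * P α γ θ k x t) (2 * t ^ 2 + (k : ℝ) ^ 2) from
    ⟨h.summable, h.tsum_eq⟩
  have hk' : 2 ≤ k ∨ k ≤ -2 := by
    rcases abs_cases k with ⟨h, _⟩ | ⟨h, _⟩ <;> omega
  have key : ∀ p x : ℤ, (x : ℝ) * besselJ (x + p) (2 * t)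
      = t * (besselJ (x + (p - 1)) (2 * t) + besselJ (x + (p + 1)) (2 * t))
        + (-(p : ℝ)) * besselJ (x + p) (2 * t) := by
    intro p x
    have := bessel_rec (x + p) t
    rw [add_sub_assoc, add_assoc x p 1] at this
    push_cast at this
    linear_combination this
  have HS : ∀ p q : ℤ, _ := fun p q => hasSum_three (2 * t) t (-(p : ℝ)) (-(q : ℝ)) p q
  simp_rw [← key] at HS
  have A := HS k k
  have B := HS (-k) (-k)
  have C := HS k (-k)
  have n1 : ¬ (k - 1 = k + 1) := by omega
  have n2 : ¬ (k + 1 = k - 1) := by omega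
  have n3 : ¬ (k - 1 = k) := by omega
  have n4 : ¬ (k + 1 = k) := by omega
  have n5 : ¬ (k = k - 1) := by omega
  have n6 : ¬ (k = k + 1) := by omega
  have m1 : ¬ (-k - 1 = -k + 1) := by omega
  have m2 : ¬ (-k + 1 = -k - 1) := by omega
  have m3 : ¬ (-k - 1 = -k) := by omega
  have m4 : ¬ (-k + 1 = -k) := by omega
  have m5 : ¬ (-k = -k - 1) := by omega
  have m6 : ¬ (-k = -k + 1) := by omega
  have c1 : ¬ (k - 1 = -k - 1) := by omega
  have c2 : ¬ (k - 1 = -k + 1) := by omega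
  have c3 : ¬ (k + 1 = -k - 1) := by omega
  have c4 : ¬ (k + 1 = -k + 1) := by omega
  have c5 : ¬ (k - 1 = -k) := by omega
  have c6 : ¬ (k + 1 = -k) := by omega
  have c7 : ¬ (k = -k - 1) := by omega
  have c8 : ¬ (k = -k + 1) := by omega
  have c9 : ¬ (k = -k) := by omega
  simp only [if_true, if_neg n1, if_neg n2, if_neg n3, if_neg n4, if_neg n5, if_neg n6] at A
  simp only [if_true, if_neg m1, if_neg m2, if_neg m3, if_neg m4, if_neg m5, if_neg m6] at B
  simp only [if_neg c1, if_neg c2, if_neg c3, if_neg c4, if_neg c5, if_neg c6, if_neg c7,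
    if_neg c8, if_neg c9] at C
  have H := ((A.mul_left (Real.cos θ ^ 2)).add (B.mul_left (Real.sin θ ^ 2))).add
    (C.mul_left (2 * (-1 : ℝ) ^ k * Real.cos (2 * α * k + γ) * Real.cos θ * Real.sin θ))
  have E := Real.sin_sq_add_cos_sq θ
  have H2 := H.congr_fun (g := fun x : ℤ => (x : ℝ) ^ 2 * P α γ θ k x t) (fun x => by
    unfold P
    rw [sub_eq_add_neg]
    ring)
  refine Eq.mp (congrArg (fun s => HasSum (fun x : ℤ => (x : ℝ) ^ 2 * P α γ θ k x t) s) ?_) H2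
  push_cast
  linear_combination (2 * t ^ 2 + (k : ℝ) ^ 2) * E
end

section
/- For every z ∈ ℝ and every k ∈ ℤ, the function x ↦ x·J_{x+k}(z)·J_{x-k}(z) is summable over ℤ and ∑_{x ∈ ℤ} x·J_{x+k}(z)·J_{x-k}(z) = 0. -/
open scoped Real

theorem besselJ_neg (n : ℤ) (z : ℝ) : besselJ (-n) z = (-1 : ℝ) ^ n * besselJ n z := by
  unfold besselJ
  have h := intervalIntegral.integral_comp_sub_left
    (fun τ => Real.cos (((-n : ℤ) : ℝ) * τ - z * Real.sin τ)) (a := 0) (b := π) π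
  simp only [sub_self, sub_zero] at h
  rw [← h]
  have h2 : ∀ x : ℝ, Real.cos (((-n : ℤ) : ℝ) * (π - x) - z * Real.sin (π - x))
      = (-1 : ℝ) ^ n * Real.cos (n * x - z * Real.sin x) := by
    intro x
    rw [Real.sin_pi_sub, ← Real.cos_sub_int_mul_pi]
    congr 1
    push_cast
    ring
  simp only [h2]
  rw [intervalIntegral.integral_const_mul]
  ring

theorem besselJ_abs_le (n : ℤ) (z : ℝ) : |besselJ n z| ≤ 1 := by
  unfold besselJ
  have h := intervalIntegral.norm_integral_le_of_norm_le_const (a := 0) (b := π) (C := 1)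
    (f := fun τ => Real.cos (n * τ - z * Real.sin τ)) (fun x _ => by
      simpa using Real.abs_cos_le_one _)
  rw [Real.norm_eq_abs, sub_zero, abs_of_pos Real.pi_pos, one_mul] at h
  rw [abs_mul, abs_of_pos (by positivity), one_div, inv_mul_le_iff₀ Real.pi_pos]
  simpa using h

theorem besselJ_rec (n : ℤ) (z : ℝ) :
    n * besselJ n z = z / 2 * (besselJ (n - 1) z + besselJ (n + 1) z) := by
  have hi : ∀ m : ℤ, IntervalIntegrable (fun τ => Real.cos (m * τ - z * Real.sin τ))
      MeasureTheory.volume 0 π := fun m => by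
    apply Continuous.intervalIntegrable
    fun_prop
  have h := intervalIntegral.integral_eq_sub_of_hasDerivAt (a := 0) (b := π)
    (f := fun τ => Real.sin (n * τ - z * Real.sin τ))
    (f' := fun τ => Real.cos (n * τ - z * Real.sin τ) * (n * 1 - z * Real.cos τ))
    (fun x _ => (((hasDerivAt_id x).const_mul (n : ℝ)).sub
      ((Real.hasDerivAt_sin x).const_mul z)).sin)
    (by apply Continuous.intervalIntegrable; fun_prop)
  simp only [Real.sin_pi, mul_zero, sub_zero, Real.sin_zero, Real.sin_int_mul_pi] at h
  have h2 : ∀ τ : ℝ, Real.cos (n * τ - z * Real.sin τ) * (n * 1 - z * Real.cos τ)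
      = n * Real.cos (n * τ - z * Real.sin τ)
        - z / 2 * (Real.cos ((n - 1 : ℤ) * τ - z * Real.sin τ)
          + Real.cos ((n + 1 : ℤ) * τ - z * Real.sin τ)) := by
    intro τ
    have e1 : ((n - 1 : ℤ) : ℝ) * τ - z * Real.sin τ = (n * τ - z * Real.sin τ) - τ := by
      push_cast; ring
    have e2 : ((n + 1 : ℤ) : ℝ) * τ - z * Real.sin τ = (n * τ - z * Real.sin τ) + τ := by
      push_cast; ring
    rw [e1, e2, Real.cos_sub _ τ, Real.cos_add _ τ]
    ring
  simp only [h2] at h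
  rw [intervalIntegral.integral_sub ((hi n).const_mul _)
    (((hi (n - 1)).add (hi (n + 1))).const_mul _), intervalIntegral.integral_const_mul,
    intervalIntegral.integral_const_mul, intervalIntegral.integral_add (hi _) (hi _)] at h
  unfold besselJ
  linear_combination (1 / π) * h

theorem besselJ_mul_le (n : ℤ) (z : ℝ) : |n * besselJ n z| ≤ |z| := by
  rw [besselJ_rec, abs_mul, abs_div, abs_two]
  have h1 := besselJ_abs_le (n - 1) z
  have h2 := besselJ_abs_le (n + 1) z
  have h3 := abs_add_le (besselJ (n - 1) z) (besselJ (n + 1) z)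
  nlinarith [abs_nonneg z]

theorem besselJ_sq_mul_le (n : ℤ) (z : ℝ) :
    |(n : ℝ) ^ 2 * besselJ n z| ≤ |z| * (|z| + 1) := by
  have e : (n : ℝ) ^ 2 * besselJ n z = z / 2 *
      ((((n - 1 : ℤ) : ℝ) * besselJ (n - 1) z + besselJ (n - 1) z)
        + (((n + 1 : ℤ) : ℝ) * besselJ (n + 1) z - besselJ (n + 1) z)) := by
    push_cast
    linear_combination (n : ℝ) * besselJ_rec n z
  rw [e, abs_mul, abs_div, abs_two]
  have h1 := besselJ_abs_le (n - 1) z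
  have h2 := besselJ_abs_le (n + 1) z
  have h3 := besselJ_mul_le (n - 1) z
  have h4 := besselJ_mul_le (n + 1) z
  have h5 : |(((n - 1 : ℤ) : ℝ) * besselJ (n - 1) z + besselJ (n - 1) z)
        + (((n + 1 : ℤ) : ℝ) * besselJ (n + 1) z - besselJ (n + 1) z)| ≤ 2 * (|z| + 1) := by
    rw [abs_le] at *
    constructor <;> linarith [h1.1, h1.2, h2.1, h2.2, h3.1, h3.2, h4.1, h4.2]
  nlinarith [abs_nonneg z]

theorem besselJ_summable (z : ℝ) : Summable (fun n : ℤ => |besselJ n z|) := by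
  have hs : Summable (fun n : ℤ => |z| * (|z| + 1) * (1 / (n : ℝ) ^ 2)) :=
    (Real.summable_one_div_int_pow.mpr one_lt_two).mul_left _
  refine Summable.of_norm_bounded_eventually hs ?_
  have : ∀ᶠ n : ℤ in Filter.cofinite, n ≠ 0 := (Set.finite_singleton (0 : ℤ)).compl_mem_cofinite
  filter_upwards [this] with n hn
  have hn' : (0 : ℝ) < (n : ℝ) ^ 2 := by positivity
  have h := besselJ_sq_mul_le n z
  rw [abs_mul, abs_of_pos hn'] at h
  rw [Real.norm_eq_abs, abs_abs, mul_one_div, le_div_iff₀ hn']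
  linarith

theorem cross_term_odd (z : ℝ) (k x : ℤ) :
    ((-x : ℤ) : ℝ) * besselJ (-x + k) z * besselJ (-x - k) z
      = -((x : ℝ) * besselJ (x + k) z * besselJ (x - k) z) := by
  have e1 : -x + k = -(x - k) := by ring
  have e2 : -x - k = -(x + k) := by ring
  have e3 : (-1 : ℝ) ^ (x - k) * (-1 : ℝ) ^ (x + k) = 1 := by
    rw [← zpow_add₀ (by norm_num)]
    exact Even.neg_one_zpow ⟨x, by ring⟩
  rw [e1, e2, besselJ_neg, besselJ_neg, Int.cast_neg]
  linear_combination (-(x : ℝ) * besselJ (x + k) z * besselJ (x - k) z) * e3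

theorem cross_term_summable (z : ℝ) (k : ℤ) :
    Summable (fun x : ℤ => (x : ℝ) * besselJ (x + k) z * besselJ (x - k) z) := by
  have s1 : Summable (fun x : ℤ => |besselJ (x + k) z|) :=
    (besselJ_summable z).comp_injective (add_left_injective k)
  have s2 : Summable (fun x : ℤ => |besselJ (x - k) z|) :=
    (besselJ_summable z).comp_injective (sub_left_injective (b := k))
  refine Summable.of_norm_bounded ((s1.add s2).mul_left (|z| / 2)) ?_
  intro x
  have e : (x : ℝ) * besselJ (x + k) z * besselJ (x - k) z =
      (((x + k : ℤ) : ℝ) * besselJ (x + k) z) * besselJ (x - k) z / 2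
      + (((x - k : ℤ) : ℝ) * besselJ (x - k) z) * besselJ (x + k) z / 2 := by
    push_cast; ring
  rw [e, Real.norm_eq_abs]
  refine (abs_add_le _ _).trans ?_
  rw [abs_div, abs_div, abs_two]
  have h1 := mul_le_mul_of_nonneg_right (besselJ_mul_le (x + k) z)
    (abs_nonneg (besselJ (x - k) z))
  have h2 := mul_le_mul_of_nonneg_right (besselJ_mul_le (x - k) z)
    (abs_nonneg (besselJ (x + k) z))
  simp only [abs_mul] at h1 h2 ⊢
  linarith

/-- The cross (interference) term contributes nothing to the first moment:
`∑_{x ∈ ℤ} x J_{x+k}(z) J_{x-k}(z) = 0`. -/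
theorem cross_term_first_moment (z : ℝ) (k : ℤ) :
    Summable (fun x : ℤ => (x : ℝ) * besselJ (x + k) z * besselJ (x - k) z) ∧
    ∑' x : ℤ, (x : ℝ) * besselJ (x + k) z * besselJ (x - k) z = 0 := by
  constructor
  · exact cross_term_summable z k
  · have h := (Equiv.neg ℤ).tsum_eq
      (fun x : ℤ => (x : ℝ) * besselJ (x + k) z * besselJ (x - k) z)
    simp only [Equiv.neg_apply, cross_term_odd, tsum_neg] at h
    linarith
end
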